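/- There do not exist real numbers ξ₁, ξ₂, ξ₃ and real numbers α, β, γ such that simultaneously ξ₁ + ξ₂ + ξ₃ = 0, ξ₁·e^{iα} + ξ₂·e^{iβ} + ξ₃·e^{iγ} = i, and ξ₁·e^{2iα} + ξ₂·e^{2iβ} + ξ₃·e^{2iγ} = 2i (equalities of complex numbers, with i the imaginary unit). -/

import Mathlib

open Complex

lemma shift_aux_term (a a' b c : ℂ) (h : a * a' = 1) :
    a - (a + b + c) + (a * b + b * c + c * a) * a' - a * b * c * a' ^ 2 = 0 := by
  linear_combination (b + c - b * c * a') * h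

lemma shift_aux_term2 (a a' b c : ℂ) (h : a * a' = 1) :
    a ^ 2 - (a + b + c) * a + (a * b + b * c + c * a) - a * b * c * a' = 0 := by
  linear_combination (- b * c) * h

lemma shift_aux_fin (t c : ℂ) (h1 : t * (c - 1) = I) (h2 : t * (c ^ 2 - 1) = 2 * I) : False := by
  have h : I * (c - 1) = 0 := by linear_combination h2 - (c + 1) * h1
  have hc : c - 1 = 0 := (mul_eq_zero.mp h).resolve_left I_ne_zero
  rw [hc, mul_zero] at h1
  exact I_ne_zero h1.symm

lemma shift_aux_one (x y z b c : ℂ) (e0 : x + y + z = 0) (e1 : x + y * b + z * c = I)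
    (e2 : x + y * b ^ 2 + z * c ^ 2 = 2 * I) (h : (1 - b) * (1 - c) = 0) : False := by
  rcases mul_eq_zero.mp h with h | h
  · obtain rfl : b = 1 := by linear_combination -h
    exact shift_aux_fin z c (by linear_combination e1 - e0) (by linear_combination e2 - e0)
  · obtain rfl : c = 1 := by linear_combination -h
    exact shift_aux_fin y b (by linear_combination e1 - e0) (by linear_combination e2 - e0)

lemma shift_aux_main (x y z a b c a' b' c' : ℂ) (ha : a * a' = 1) (hb : b * b' = 1)
    (hc : c * c' = 1) (e0 : x + y + z = 0) (e1 : x * a + y * b + z * c = I)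
    (e2 : x * a ^ 2 + y * b ^ 2 + z * c ^ 2 = 2 * I)
    (f1 : x * a' + y * b' + z * c' = -I)
    (f2 : x * a' ^ 2 + y * b' ^ 2 + z * c' ^ 2 = -(2 * I)) : False := by
  have g1 : I * (1 - (a * b + b * c + c * a) + 2 * (a * b * c)) = 0 := by
    linear_combination x * shift_aux_term a a' b c ha + y * shift_aux_term b b' c a hb
      + z * shift_aux_term c c' a b hc - e1 + (a + b + c) * e0
      - (a * b + b * c + c * a) * f1 + a * b * c * f2
  have g2 : I * (2 - (a + b + c) + a * b * c) = 0 := by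
    linear_combination x * shift_aux_term2 a a' b c ha + y * shift_aux_term2 b b' c a hb
      + z * shift_aux_term2 c c' a b hc - e2 + (a + b + c) * e1
      - (a * b + b * c + c * a) * e0 + a * b * c * f1
  have g1 := (mul_eq_zero.mp g1).resolve_left I_ne_zero
  have g2 := (mul_eq_zero.mp g2).resolve_left I_ne_zero
  have hP : (1 - a) * ((1 - b) * (1 - c)) = 0 := by linear_combination g2 - g1
  by_cases h1 : a = 1
  · subst h1
    exact shift_aux_one x y z b c e0 (by linear_combination e1) (by linear_combination e2)
      (by linear_combination g2)
  have h : (1 - b) * (1 - c) = 0 :=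
    (mul_eq_zero.mp hP).resolve_left (fun h => h1 (by linear_combination -h))
  rcases mul_eq_zero.mp h with h | h
  · obtain rfl : b = 1 := by linear_combination -h
    exact shift_aux_one y x z a c (by linear_combination e0) (by linear_combination e1)
      (by linear_combination e2) (by linear_combination g2)
  · obtain rfl : c = 1 := by linear_combination -h
    exact shift_aux_one z x y a b (by linear_combination e0) (by linear_combination e1)
      (by linear_combination e2) (by linear_combination g2)

/-- The system of complex equations characterising a three-term parameter-shift rule
for frequencies 0, 1, 2 has no real solution. -/
theorem no_three_term_shift_system :
    ¬ ∃ (ξ₁ ξ₂ ξ₃ α β γ : ℝ),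
      ξ₁ + ξ₂ + ξ₃ = 0 ∧
      (ξ₁ : ℂ) * Complex.exp (I * α) + (ξ₂ : ℂ) * Complex.exp (I * β) +
        (ξ₃ : ℂ) * Complex.exp (I * γ) = I ∧
      (ξ₁ : ℂ) * Complex.exp (2 * I * α) + (ξ₂ : ℂ) * Complex.exp (2 * I * β) +
        (ξ₃ : ℂ) * Complex.exp (2 * I * γ) = 2 * I := by
  rintro ⟨x, y, z, α, β, γ, e0, e1, e2⟩
  have hsq : ∀ t : ℝ, Complex.exp (2 * I * t) = Complex.exp (I * t) ^ 2 := by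
    intro t
    rw [← Complex.exp_nat_mul]
    congr 1
    push_cast
    ring
  have hu : ∀ t : ℝ, Complex.exp (I * t) * (starRingEnd ℂ) (Complex.exp (I * t)) = 1 := by
    intro t
    rw [← Complex.exp_conj, ← Complex.exp_add]
    simp
  rw [hsq, hsq, hsq] at e2
  have f1 := congrArg (starRingEnd ℂ) e1
  have f2 := congrArg (starRingEnd ℂ) e2
  simp only [map_add, map_mul, map_pow, Complex.conj_ofReal, Complex.conj_I, map_ofNat] at f1 f2
  exact shift_aux_main x y z _ _ _ _ _ _ (hu α) (hu β) (hu γ) (by exact_mod_cast e0) e1 e2 f1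
    (by rw [f2]; ring)
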